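/- Let c be a redundant 1-cell of UD^nΓ with unique edge e, and let v be the smallest unblocked vertex of c. Let c' be the cell obtained from c by replacing v with τ(e(v)). If no vertex u satisfying τ(e(v)) < u < v in the vertex order is an element of c or an endpoint of e, then c →̇ c', where c and c' are regarded as length-one words consisting of their positive orientations. -/

import Mathlib

open SimpleGraph

attribute [local instance] Classical.propDecidable

namespace GraphBraid

/-- The degree of a vertex, defined via `Set.ncard` to avoid decidability assumptions. -/
noncomputable def ncdeg {V : Type} (H : SimpleGraph V) (v : V) : ℕ := (H.neighborSet v).ncard

/-- The basic setup: a finite connected simple graph `G` with a spanning tree `T`,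
a root `root` of degree one in `T`, and a labelling of the edges of `T` incident to each
vertex `u` by the numbers `0, …, d_T(u) - 1`, where the edge towards the root receives the
label `0` (and the unique edge at the root receives the label `1`). -/
structure Setup (V : Type) [Fintype V] [DecidableEq V] where
  G : SimpleGraph V
  G_conn : G.Connected
  T : SimpleGraph V
  T_le : T ≤ G
  T_tree : T.IsTree
  root : V
  root_deg : ncdeg T root = 1
  label : V → V → ℕ
  label_bij : ∀ u : V, u ≠ root → Set.BijOn (label u) (T.neighborSet u) (Set.Iio (ncdeg T u))
  label_zero : ∀ u : V, u ≠ root → ∀ w : V, T.Adj u w →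
    (label u w = 0 ↔ T.dist root w + 1 = T.dist root u)
  label_root : ∀ w : V, T.Adj root w → label root w = 1

namespace Setup

variable {V : Type} [Fintype V] [DecidableEq V] (S : Setup V)

/-- The unique geodesic (path) in the tree `T` from `u` to `w`. -/
noncomputable def geod (u w : V) : S.T.Walk u w := (S.T_tree.existsUnique_path u w).choose

/-- `g(u,w)`: the label at `u` of the first edge of the tree geodesic from `u` to `w`,
with `g(u,u) = 0`. -/
noncomputable def gfun (u w : V) : ℕ :=
  if u = w then 0 else S.label u ((S.geod u w).getVert 1)

lemma exists_wedge (u w : V) :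
    ∃ x : V, (x ∈ (S.geod S.root u).support ∧ x ∈ (S.geod S.root w).support) ∧
      ∀ y : V, y ∈ (S.geod S.root u).support → y ∈ (S.geod S.root w).support →
        S.T.dist S.root y ≤ S.T.dist S.root x := by
  classical
  have hne : ((S.geod S.root u).support.toFinset ∩
      (S.geod S.root w).support.toFinset).Nonempty :=
    ⟨S.root, by simp [SimpleGraph.Walk.start_mem_support]⟩
  obtain ⟨x, hx, hmax⟩ := Finset.exists_max_image _ (fun y => S.T.dist S.root y) hne
  simp only [Finset.mem_inter, List.mem_toFinset] at hx hmax
  exact ⟨x, ⟨hx.1, hx.2⟩, fun y h1 h2 => hmax y ⟨h1, h2⟩⟩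

/-- `u ∧ w`: the vertex farthest from the root lying on both tree geodesics from the
root to `u` and from the root to `w`. -/
noncomputable def wedge (u w : V) : V := (S.exists_wedge u w).choose

/-- The order on vertices: `u ≤ w` iff `u ∧ w = u`, or `u ∧ w ≠ u` and
`g(u ∧ w, u) < g(u ∧ w, w)`. -/
def vle (u w : V) : Prop :=
  S.wedge u w = u ∨ (S.wedge u w ≠ u ∧ S.gfun (S.wedge u w) u < S.gfun (S.wedge u w) w)

/-- The associated strict order on vertices. -/
def vlt (u w : V) : Prop := S.vle u w ∧ u ≠ w

/-- `ι(e)`: the larger endpoint of the edge `e` in the vertex order. -/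
noncomputable def iota (e : Sym2 V) : V :=
  if S.vle (Quot.out e).1 (Quot.out e).2 then (Quot.out e).2 else (Quot.out e).1

/-- `τ(e)`: the smaller endpoint of the edge `e` in the vertex order. -/
noncomputable def tau (e : Sym2 V) : V :=
  if S.vle (Quot.out e).1 (Quot.out e).2 then (Quot.out e).1 else (Quot.out e).2

/-- `e(v)`: the edge of `T` incident to `v` lying on the tree geodesic from `v` to the root. -/
noncomputable def eV (v : V) : Sym2 V := s(v, (S.geod v S.root).getVert 1)

/-- A cell of `UD^n Γ`: an `n`-element set whose elements are vertices (encoded as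
diagonal elements of `Sym2 V`) and closed edges of `G`, no two distinct elements of which
share a vertex. -/
def IsCell (n : ℕ) (c : Finset (Sym2 V)) : Prop :=
  c.card = n ∧ (∀ s ∈ c, s.IsDiag ∨ s ∈ S.G.edgeSet) ∧
    ∀ s ∈ c, ∀ t ∈ c, s ≠ t → ∀ x : V, x ∈ s → x ∉ t

/-- The dimension of a cell: the number of edges it contains. -/
noncomputable def dim (c : Finset (Sym2 V)) : ℕ := (c.filter (fun s => ¬ s.IsDiag)).card

/-- A vertex `v` is blocked in `c` if `v` is the root, or `e(v)` shares a vertex with some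
element of `c` other than `v`. -/
def Blocked (c : Finset (Sym2 V)) (v : V) : Prop :=
  v = S.root ∨ ∃ s ∈ c, s ≠ Sym2.diag v ∧ ∃ x : V, x ∈ S.eV v ∧ x ∈ s

/-- A vertex `v` is unblocked in `c` if it belongs to `c` and is not blocked. -/
def Unblocked (c : Finset (Sym2 V)) (v : V) : Prop := Sym2.diag v ∈ c ∧ ¬ S.Blocked c v

/-- The elementary reduction of `c` from the vertex `v`: replace `v` by the edge `e(v)`. -/
noncomputable def redFrom (c : Finset (Sym2 V)) (v : V) : Finset (Sym2 V) :=
  insert (S.eV v) (c.erase (Sym2.diag v))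

/-- `c'` is the principal elementary reduction of `c`: it is the elementary reduction of `c`
from the smallest unblocked vertex of `c`. -/
def PrincipalRedOf (c c' : Finset (Sym2 V)) : Prop :=
  ∃ v : V, S.Unblocked c v ∧ (∀ u : V, S.Unblocked c u → S.vle v u) ∧ c' = S.redFrom c v

/-- Auxiliary definition of redundancy, by induction on the dimension: a cell of
dimension `i` is redundant iff it has an unblocked vertex and it is not the principal
elementary reduction of a redundant cell of dimension `i - 1`. -/
def RedundantAux (n : ℕ) : ℕ → Finset (Sym2 V) → Prop
  | 0, c => ∃ v, S.Unblocked c v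
  | (i + 1), c => (∃ v, S.Unblocked c v) ∧
      ¬ ∃ c₀, S.IsCell n c₀ ∧ dim c₀ = i ∧ RedundantAux n i c₀ ∧ S.PrincipalRedOf c₀ c

/-- A cell is redundant if the discrete vector field `W` is defined on it. -/
def Redundant (n : ℕ) (c : Finset (Sym2 V)) : Prop := S.RedundantAux n (dim c) c

/-- A cell is collapsible if it lies in the image of `W`. -/
def Collapsible (n : ℕ) (c : Finset (Sym2 V)) : Prop :=
  ∃ c₀, S.IsCell n c₀ ∧ S.Redundant n c₀ ∧ S.PrincipalRedOf c₀ c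

/-- A cell is critical if it is neither redundant nor collapsible. -/
def Critical (n : ℕ) (c : Finset (Sym2 V)) : Prop :=
  ¬ S.Redundant n c ∧ ¬ S.Collapsible n c

/-- An edge `e` of the cell `c` is order-respecting in `c` if `e` lies in `T` and every
vertex `v ∈ c` such that `e(v)` and `e` share the vertex `τ(e)` satisfies `v > ι(e)`. -/
def OrderResp (c : Finset (Sym2 V)) (e : Sym2 V) : Prop :=
  e ∈ c ∧ e ∈ S.T.edgeSet ∧
    ∀ v : V, v ≠ S.root → Sym2.diag v ∈ c → S.tau e ∈ S.eV v → S.vlt (S.iota e) v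

/-- `e` is the minimal order-respecting edge of `c`. -/
def MinOrderResp (c : Finset (Sym2 V)) (e : Sym2 V) : Prop :=
  S.OrderResp c e ∧ ∀ e' : Sym2 V, S.OrderResp c e' → S.vle (S.iota e) (S.iota e')

/-- `c'` is a face of `c` obtained by replacing one edge of `c` by one of its endpoints. -/
def IsFace (c' c : Finset (Sym2 V)) : Prop :=
  ∃ (e : Sym2 V) (x : V), e ∈ c ∧ ¬ e.IsDiag ∧ x ∈ e ∧ c' = insert (Sym2.diag x) (c.erase e)

/-- `Γ` is sufficiently subdivided for `n`: every path between distinct vertices of degree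
`≠ 2` passes through at least `n - 1` edges, and every cycle has length at least `n + 1`. -/
def SuffSubdiv (n : ℕ) : Prop :=
  (∀ u v : V, u ≠ v → ncdeg S.G u ≠ 2 → ncdeg S.G v ≠ 2 →
    ∀ p : S.G.Walk u v, p.IsPath → n - 1 ≤ p.length) ∧
  (∀ v : V, ∀ p : S.G.Walk v v, p.IsCycle → n + 1 ≤ p.length)

end Setup

/-- Reversal of orientation of an oriented 1-cell. -/
def bar {V : Type} (a : Finset (Sym2 V) × Bool) : Finset (Sym2 V) × Bool := (a.1, !a.2)

/-- The formal inverse of a word of oriented 1-cells. -/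
def wordInv {V : Type} (w : List (Finset (Sym2 V) × Bool)) : List (Finset (Sym2 V) × Bool) :=
  (w.map bar).reverse

namespace Setup

variable {V : Type} [Fintype V] [DecidableEq V] (S : Setup V)

/-- The unique edge of a 1-cell (with a junk value if the cell contains no edge). -/
noncomputable def theEdge (c : Finset (Sym2 V)) : Sym2 V :=
  if h : (c.filter (fun s => ¬ s.IsDiag)).Nonempty then h.choose else Sym2.diag S.root

/-- The source 0-cell of an oriented 1-cell: a positively oriented 1-cell runs from the
0-cell obtained by replacing its edge `e` with `ι(e)` to the one obtained by replacing `e`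
with `τ(e)`. -/
noncomputable def src (a : Finset (Sym2 V) × Bool) : Finset (Sym2 V) :=
  insert (Sym2.diag (if a.2 then S.iota (S.theEdge a.1) else S.tau (S.theEdge a.1)))
    (a.1.erase (S.theEdge a.1))

/-- The target 0-cell of an oriented 1-cell. -/
noncomputable def tgt (a : Finset (Sym2 V) × Bool) : Finset (Sym2 V) :=
  insert (Sym2.diag (if a.2 then S.tau (S.theEdge a.1) else S.iota (S.theEdge a.1)))
    (a.1.erase (S.theEdge a.1))

/-- `w` is a boundary word of the 2-cell `σ`: a closed loop of length 4 in the 1-skeleton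
reading the four faces of `σ`, each with the orientation induced by the traversal. -/
def IsBoundaryWord (n : ℕ) (σ : Finset (Sym2 V)) (w : List (Finset (Sym2 V) × Bool)) : Prop :=
  ∃ a b c d : Finset (Sym2 V) × Bool, w = [a, b, c, d] ∧
    S.tgt a = S.src b ∧ S.tgt b = S.src c ∧ S.tgt c = S.src d ∧ S.tgt d = S.src a ∧
    ([a.1, b.1, c.1, d.1] : List (Finset (Sym2 V))).Nodup ∧
    (∀ x ∈ [a, b, c, d], S.IsCell n x.1 ∧ dim x.1 = 1) ∧
    (∀ c' : Finset (Sym2 V), IsFace c' σ ↔ c' ∈ [a.1, b.1, c.1, d.1])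

end Setup

/-- The relations of the monoid presentation `MP_W`: collapsible 1-cells are trivial, free
reduction, and each collapsible 2-cell `σ = W(c₀)` gives relations `(a, w̄)` and `(ā, w)`
for a boundary word `a·w` of `σ` starting with an orientation `a` of `c₀`. -/
inductive MPRel {V : Type} [Fintype V] [DecidableEq V] (S : Setup V) (n : ℕ) :
    List (Finset (Sym2 V) × Bool) → List (Finset (Sym2 V) × Bool) → Prop
  | collapse (a : Finset (Sym2 V) × Bool) (h1 : S.IsCell n a.1) (h2 : Setup.dim a.1 = 1)
      (h3 : S.Collapsible n a.1) : MPRel S n [a] []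
  | cancel (a : Finset (Sym2 V) × Bool) (h1 : S.IsCell n a.1) (h2 : Setup.dim a.1 = 1) :
      MPRel S n [a, bar a] []
  | square (σ c₀ : Finset (Sym2 V)) (a : Finset (Sym2 V) × Bool)
      (w : List (Finset (Sym2 V) × Bool)) (hσ : S.IsCell n σ) (hd : Setup.dim σ = 2)
      (hc₀ : S.IsCell n c₀) (hred : S.Redundant n c₀) (hW : S.PrincipalRedOf c₀ σ)
      (ha : a.1 = c₀) (hbw : S.IsBoundaryWord n σ (a :: w)) (hno : ∀ x ∈ w, x.1 ≠ c₀) :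
      MPRel S n [a] (wordInv w)
  | squareInv (σ c₀ : Finset (Sym2 V)) (a : Finset (Sym2 V) × Bool)
      (w : List (Finset (Sym2 V) × Bool)) (hσ : S.IsCell n σ) (hd : Setup.dim σ = 2)
      (hc₀ : S.IsCell n c₀) (hred : S.Redundant n c₀) (hW : S.PrincipalRedOf c₀ σ)
      (ha : a.1 = c₀) (hbw : S.IsBoundaryWord n σ (a :: w)) (hno : ∀ x ∈ w, x.1 ≠ c₀) :
      MPRel S n [bar a] w

/-- A single move of the string rewriting system associated to `MP_W`. -/
def MPMove {V : Type} [Fintype V] [DecidableEq V] (S : Setup V) (n : ℕ)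
    (x y : List (Finset (Sym2 V) × Bool)) : Prop :=
  ∃ u v r₁ r₂ : List (Finset (Sym2 V) × Bool),
    MPRel S n r₁ r₂ ∧ x = u ++ r₁ ++ v ∧ y = u ++ r₂ ++ v

/-! ### List lemmas -/

lemma list_append_lt_iff (p x y : List ℕ) : p ++ x < p ++ y ↔ x < y := by
  induction p with
  | nil => simp
  | cons a p ih => simp [ih]

lemma list_append_lt_self (p : List ℕ) (a : ℕ) (l : List ℕ) : p < p ++ a :: l := by
  have h := (list_append_lt_iff p [] (a :: l)).2 (by simp)
  simpa using h

lemma list_between (z p : List ℕ) (b : ℕ) (h1 : z < p) (h2 : p < z ++ [b]) :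
    ∃ c l, p = z ++ c :: l ∧ c < b := by
  induction z generalizing p with
  | nil =>
    cases p with
    | nil => simp at h1
    | cons c l =>
      refine ⟨c, l, rfl, ?_⟩
      simp only [List.nil_append, List.cons_lt_cons_iff] at h2
      rcases h2 with h2 | ⟨_, h2⟩
      · exact h2
      · exact absurd h2 (by simp)
  | cons a z ih =>
    cases p with
    | nil => simp at h1
    | cons c l =>
      simp only [List.cons_append, List.cons_lt_cons_iff] at h1 h2
      have hac : a = c := by omega
      subst hac
      simp at h1 h2
      obtain ⟨c, l', rfl, h⟩ := ih l h1 h2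
      exact ⟨c, l', rfl, h⟩

lemma list_between_le (p z : List ℕ) (a b : ℕ) (h1 : p < z ++ [b]) (h2 : z ++ [b] < p ++ [a]) :
    p ≤ z := by
  by_contra h
  have h : z < p := not_le.1 h
  obtain ⟨c, l, rfl, hc⟩ := list_between z p b h h1
  rw [List.append_assoc, list_append_lt_iff] at h2
  simp only [List.cons_append, List.cons_lt_cons_iff] at h2
  omega

/-! ### Geodesics and codes -/

namespace Setup

variable {V : Type} [Fintype V] [DecidableEq V] (S : Setup V)

lemma geod_isPath (u w : V) : (S.geod u w).IsPath :=
  (S.T_tree.existsUnique_path u w).choose_spec.1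

lemma geod_unique {u w : V} (p : S.T.Walk u w) (hp : p.IsPath) : p = S.geod u w :=
  (S.T_tree.existsUnique_path u w).unique hp (S.geod_isPath u w)

/-- The sequence of labels on the geodesic from the root. -/
noncomputable def code (u : V) : List ℕ :=
  (S.geod S.root u).darts.map (fun d => S.label d.fst d.snd)

lemma code_length (u : V) : (S.code u).length = S.T.dist S.root u := by
  obtain ⟨p, hp, hl⟩ := S.T_tree.1.exists_path_of_dist S.root u
  rw [← hl, S.geod_unique p hp]
  simp [code]

lemma code_root : S.code S.root = [] := by
  have := S.code_length S.root
  simpa using this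

lemma geod_append {x u : V} (hx : x ∈ (S.geod S.root u).support) :
    S.geod S.root u = (S.geod S.root x).append (S.geod x u) := by
  have h := (S.geod S.root u).take_spec hx
  have h1 := S.geod_unique _ ((S.geod_isPath S.root u).takeUntil hx)
  have h2 := S.geod_unique _ ((S.geod_isPath S.root u).dropUntil hx)
  rw [h1, h2] at h
  exact h.symm

lemma first_step {x u : V} (hx : x ∈ (S.geod S.root u).support) (hne : x ≠ u) :
    ∃ y l, S.T.Adj x y ∧ y ∈ (S.geod S.root u).support ∧ S.gfun x u = S.label x y ∧
      S.code u = S.code x ++ S.label x y :: l ∧ S.code y = S.code x ++ [S.label x y] := by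
  have h := S.geod_append hx
  have hp := S.geod_isPath S.root u
  have hg : S.gfun x u = S.label x ((S.geod x u).getVert 1) := by simp [gfun, hne]
  rw [hg]
  unfold code
  rw [h]
  rw [h] at hp
  generalize S.geod x u = q at *
  cases q with
  | nil => exact absurd rfl hne
  | @cons _ y _ hadj q =>
    have hy : S.geod S.root y = (S.geod S.root x).concat hadj := by
      symm
      apply S.geod_unique
      rw [← SimpleGraph.Walk.concat_append] at hp
      exact hp.of_append_left
    refine ⟨y, q.darts.map (fun d => S.label d.fst d.snd), hadj, ?_, ?_, ?_, ?_⟩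
    · simp
    · simp
    · simp
    · rw [hy]; simp [SimpleGraph.Walk.darts_concat]

lemma label_inj {x y z : V} (hy : S.T.Adj x y) (hz : S.T.Adj x z)
    (h : S.label x y = S.label x z) : y = z := by
  by_cases hx : x = S.root
  · subst hx
    have := S.root_deg
    unfold ncdeg at this
    rw [Set.ncard_eq_one] at this
    obtain ⟨a, ha⟩ := this
    have h1 : y ∈ S.T.neighborSet S.root := hy
    have h2 : z ∈ S.T.neighborSet S.root := hz
    rw [ha] at h1 h2
    rw [Set.mem_singleton_iff.1 h1, Set.mem_singleton_iff.1 h2]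
  · exact (S.label_bij x hx).2.1 hy hz h

lemma wedge_cases (u w : V) :
    (S.wedge u w = u ∧ u = w) ∨ (S.wedge u w = u ∧ S.code u < S.code w) ∨
    (S.wedge u w ≠ u ∧ S.gfun (S.wedge u w) u < S.gfun (S.wedge u w) w ∧
      S.code u < S.code w) ∨
    (S.wedge u w ≠ u ∧ ¬ S.gfun (S.wedge u w) u < S.gfun (S.wedge u w) w ∧
      S.code w < S.code u) := by
  have hsp := (S.exists_wedge u w).choose_spec
  change (S.wedge u w ∈ _ ∧ S.wedge u w ∈ _) ∧ ∀ y : V, _ → _ → _ ≤ S.T.dist S.root (S.wedge u w)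
    at hsp
  generalize S.wedge u w = x at *
  obtain ⟨⟨hu, hw⟩, hmax⟩ := hsp
  by_cases h1 : x = u
  · by_cases h2 : x = w
    · left; exact ⟨h1, h1 ▸ h2⟩
    · right; left
      obtain ⟨y, l, _, _, _, hc, _⟩ := S.first_step hw h2
      refine ⟨h1, ?_⟩
      rw [← h1, hc]
      exact list_append_lt_self _ _ _
  · obtain ⟨y, l, hy1, hy2, hy3, hy4, hy5⟩ := S.first_step hu h1
    right; right
    by_cases h2 : x = w
    · right
      refine ⟨h1, by simp [gfun, h2], ?_⟩
      rw [← h2, hy4]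
      exact list_append_lt_self _ _ _
    · obtain ⟨z, l', hz1, hz2, hz3, hz4, hz5⟩ := S.first_step hw h2
      have hne : S.label x y ≠ S.label x z := by
        intro h
        have := S.label_inj hy1 hz1 h
        subst this
        have := hmax y hy2 hz2
        rw [← S.code_length, ← S.code_length, hy5] at this
        simp at this
      rw [hy3, hz3, hy4, hz4, list_append_lt_iff, list_append_lt_iff]
      simp only [List.cons_lt_cons_iff]
      rcases lt_or_gt_of_ne hne with h | h
      · left; exact ⟨h1, h, Or.inl h⟩
      · right; exact ⟨h1, by omega, Or.inl h⟩

lemma vle_iff (u w : V) : S.vle u w ↔ S.code u ≤ S.code w := by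
  unfold vle
  rcases S.wedge_cases u w with ⟨h1, rfl⟩ | ⟨h1, h2⟩ | ⟨h1, h2, h3⟩ | ⟨h1, h2, h3⟩
  · simp [h1]
  · simp [h1, h2.le]
  · simp [h1, h2, h3.le]
  · simp only [h1, h2, false_or, and_false, false_iff, not_le]
    exact h3

lemma code_inj {u w : V} (h : S.code u = S.code w) : u = w := by
  rcases S.wedge_cases u w with ⟨h1, rfl⟩ | ⟨h1, h2⟩ | ⟨h1, h2, h3⟩ | ⟨h1, h2, h3⟩
  · rfl
  all_goals simp [h] at *

lemma vlt_iff (u w : V) : S.vlt u w ↔ S.code u < S.code w := by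
  unfold vlt
  rw [vle_iff, lt_iff_le_and_ne]
  constructor
  · rintro ⟨h1, h2⟩; exact ⟨h1, fun h => h2 (S.code_inj h)⟩
  · rintro ⟨h1, h2⟩; exact ⟨h1, fun h => h2 (h ▸ rfl)⟩

/-- The parent of a vertex. -/
noncomputable def par (v : V) : V := (S.geod v S.root).getVert 1

lemma par_spec {v : V} (hv : v ≠ S.root) :
    S.T.Adj v (S.par v) ∧ ∃ b, S.code v = S.code (S.par v) ++ [b] := by
  have h : S.geod v S.root = (S.geod S.root v).reverse :=
    (S.geod_unique _ (S.geod_isPath S.root v).reverse).symm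
  have hp := S.geod_isPath v S.root
  unfold par
  have hq : S.geod S.root v = (S.geod v S.root).reverse := by rw [h]; simp
  unfold code
  rw [hq]
  generalize S.geod v S.root = q at *
  cases q with
  | nil => exact absurd rfl hv
  | @cons _ y _ hadj q =>
    have hy : S.geod S.root y = q.reverse := by
      symm
      apply S.geod_unique
      exact hp.of_cons.reverse
    have hg : (SimpleGraph.Walk.cons hadj q).getVert 1 = y := by simp
    rw [hg]
    refine ⟨hadj, S.label y v, ?_⟩
    rw [hy]
    simp

lemma eV_eq (v : V) : S.eV v = s(v, S.par v) := rfl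

lemma code_par_lt {v : V} (hv : v ≠ S.root) : S.code (S.par v) < S.code v := by
  obtain ⟨_, b, hb⟩ := S.par_spec hv
  rw [hb]
  exact list_append_lt_self _ _ _

lemma par_ne {v : V} (hv : v ≠ S.root) : S.par v ≠ v :=
  (S.par_spec hv).1.ne.symm

lemma eV_edge {v : V} (hv : v ≠ S.root) : S.eV v ∈ S.G.edgeSet := by
  rw [eV_eq, SimpleGraph.mem_edgeSet]
  exact S.T_le (S.par_spec hv).1

lemma iota_tau (e : Sym2 V) :
    e = s(S.iota e, S.tau e) ∧ S.code (S.tau e) ≤ S.code (S.iota e) := by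
  have h : e = s((Quot.out e).1, (Quot.out e).2) := (Quot.out_eq e).symm
  unfold iota tau
  split_ifs with h1
  · rw [vle_iff] at h1
    refine ⟨?_, h1⟩
    rw [Sym2.eq_swap]; exact h
  · rw [vle_iff] at h1
    exact ⟨h, (not_le.1 h1).le⟩

lemma iota_eV {v : V} (hv : v ≠ S.root) : S.iota (S.eV v) = v ∧ S.tau (S.eV v) = S.par v := by
  obtain ⟨h1, h2⟩ := S.iota_tau (S.eV v)
  have h3 := S.code_par_lt hv
  generalize S.iota (S.eV v) = a at *
  generalize S.tau (S.eV v) = b at *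
  rw [eV_eq, Sym2.eq_iff] at h1
  rcases h1 with ⟨rfl, h⟩ | ⟨h, h'⟩
  · exact ⟨rfl, h.symm⟩
  · rw [← h, ← h'] at h2
    exact absurd h2 (not_le.2 h3)

lemma iota_diag (v : V) : S.iota (Sym2.diag v) = v := by
  have h1 := (S.iota_tau (Sym2.diag v)).1
  have : S.iota (Sym2.diag v) ∈ Sym2.diag v := by
    rw [Sym2.mem_iff_exists]
    exact ⟨_, h1⟩
  exact or_self_iff.1 (Sym2.mem_iff.1 this)

end Setup

/-! ### Squares -/

lemma mem_diag_iff' {V : Type} {x y : V} : x ∈ Sym2.diag y ↔ x = y := by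
  refine ⟨fun h => or_self_iff.1 (Sym2.mem_iff.1 h), fun h => Sym2.mem_iff.2 (Or.inl h)⟩

lemma diag_inj' {V : Type} {x y : V} (h : Sym2.diag x = Sym2.diag y) : x = y := by
  have : x ∈ Sym2.diag y := by rw [← h, mem_diag_iff']
  exact mem_diag_iff'.1 this

lemma isDiag_exists {V : Type} {s : Sym2 V} (h : s.IsDiag) : ∃ x, s = Sym2.diag x := by
  induction s with
  | _ a b =>
    have : a = b := by simpa using h
    subst this
    exact ⟨a, rfl⟩

namespace Setup

variable {V : Type} [Fintype V] [DecidableEq V] (S : Setup V)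

/-- The cell made of the edge `e`, the vertex `x` and the vertices in `B`. -/
noncomputable def mkc (B : Finset (Sym2 V)) (e : Sym2 V) (x : V) : Finset (Sym2 V) :=
  insert e (insert (Sym2.diag x) B)

/-- Data of a 2-cell `B ∪ {e, f}`. -/
structure Sq (n : ℕ) (B : Finset (Sym2 V)) (e f : Sym2 V) : Prop where
  card : B.card + 2 = n
  he : e ∈ S.G.edgeSet
  hf : f ∈ S.G.edgeSet
  hB : ∀ s ∈ B, s.IsDiag
  dBe : ∀ s ∈ B, ∀ x ∈ s, x ∉ e
  dBf : ∀ s ∈ B, ∀ x ∈ s, x ∉ f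
  de : ∀ x ∈ e, x ∉ f

variable {S}

lemma not_diag_of_edge {e : Sym2 V} (h : e ∈ S.G.edgeSet) : ¬ e.IsDiag :=
  S.G.not_isDiag_of_mem_edgeSet h

namespace Sq

variable {n : ℕ} {B : Finset (Sym2 V)} {e f : Sym2 V}

lemma symm (h : S.Sq n B e f) : S.Sq n B f e :=
  ⟨h.card, h.hf, h.he, h.hB, h.dBf, h.dBe, fun x hx hx' => h.de x hx' hx⟩

lemma e_nB (h : S.Sq n B e f) : e ∉ B := fun h' => not_diag_of_edge h.he (h.hB _ h')

lemma diag_nB (h : S.Sq n B e f) {x : V} (hx : x ∈ f) : Sym2.diag x ∉ B :=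
  fun h' => h.dBf _ h' x (mem_diag_iff'.2 rfl) hx

lemma e_ne_diag (h : S.Sq n B e f) (x : V) : e ≠ Sym2.diag x := by
  intro h'
  apply not_diag_of_edge h.he
  rw [h']
  exact Sym2.diag_isDiag x

lemma e_n (h : S.Sq n B e f) (x : V) : e ∉ insert (Sym2.diag x) B := by
  simp [h.e_nB, h.e_ne_diag x]

lemma e_ne_f (h : S.Sq n B e f) : e ≠ f := by
  intro h'
  exact h.de (S.iota e) (Sym2.mem_iff_exists.2 ⟨_, (S.iota_tau e).1⟩)
    (h' ▸ Sym2.mem_iff_exists.2 ⟨_, (S.iota_tau e).1⟩)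

lemma B_disj (h : S.Sq n B e f) {s t : Sym2 V} (hs : s ∈ B) (ht : t ∈ B) (hst : s ≠ t) (x : V)
    (hx : x ∈ s) : x ∉ t := by
  obtain ⟨a, rfl⟩ := isDiag_exists (h.hB s hs)
  obtain ⟨b, rfl⟩ := isDiag_exists (h.hB t ht)
  rw [mem_diag_iff'] at *
  rintro rfl
  exact hst (by rw [hx])

lemma isCell_mk (h : S.Sq n B e f) {x : V} (hx : x ∈ f) : S.IsCell n (mkc B e x) := by
  refine ⟨?_, ?_, ?_⟩
  · rw [mkc, Finset.card_insert_of_notMem (h.e_n x), Finset.card_insert_of_notMem (h.diag_nB hx),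
      ← h.card]
  · intro s hs
    simp only [mkc, Finset.mem_insert] at hs
    rcases hs with rfl | rfl | hs
    · exact Or.inr h.he
    · exact Or.inl (Sym2.diag_isDiag x)
    · exact Or.inl (h.hB s hs)
  · intro s hs t ht hst y hys hyt
    simp only [mkc, Finset.mem_insert] at hs ht
    have h1 : ∀ y, y ∈ Sym2.diag x → y ∉ e := by
      intro y hy hye
      rw [mem_diag_iff'] at hy
      exact h.de y hye (hy ▸ hx)
    have h2 : ∀ s ∈ B, ∀ y, y ∈ s → y ∉ Sym2.diag x := by
      intro s hs y hy hyx
      rw [mem_diag_iff'] at hyx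
      exact h.dBf s hs y hy (hyx ▸ hx)
    rcases hs with rfl | rfl | hs <;> rcases ht with rfl | rfl | ht
    · exact hst rfl
    · exact h1 y hyt hys
    · exact h.dBe t ht y hyt hys
    · exact h1 y hys hyt
    · exact hst rfl
    · exact h2 t ht y hyt hys
    · exact h.dBe s hs y hys hyt
    · exact h2 s hs y hys hyt
    · exact h.B_disj hs ht hst y hys hyt

lemma filter_B (h : S.Sq n B e f) : B.filter (fun s => ¬ s.IsDiag) = ∅ := by
  rw [Finset.filter_eq_empty_iff]
  intro s hs h'
  exact h' (h.hB s hs)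

lemma filter_mk (h : S.Sq n B e f) (x : V) : (mkc B e x).filter (fun s => ¬ s.IsDiag) = {e} := by
  ext s
  simp only [mkc, Finset.mem_filter, Finset.mem_insert, Finset.mem_singleton]
  constructor
  · rintro ⟨rfl | rfl | hs, h'⟩
    · rfl
    · exact absurd (Sym2.diag_isDiag x) h'
    · exact absurd (h.hB s hs) h'
  · rintro rfl
    exact ⟨Or.inl rfl, not_diag_of_edge h.he⟩

lemma dim_mk (h : S.Sq n B e f) (x : V) : dim (mkc B e x) = 1 := by
  rw [dim, h.filter_mk x]; simp

lemma theEdge_mk (h : S.Sq n B e f) (x : V) : S.theEdge (mkc B e x) = e := by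
  have hne : ((mkc B e x).filter (fun s => ¬ s.IsDiag)).Nonempty := by
    rw [h.filter_mk x]; simp
  unfold theEdge
  rw [dif_pos hne]
  have := hne.choose_spec
  generalize hne.choose = y at this ⊢
  rwa [h.filter_mk x, Finset.mem_singleton] at this

lemma erase_mk (h : S.Sq n B e f) (x : V) : (mkc B e x).erase e = insert (Sym2.diag x) B :=
  Finset.erase_insert (h.e_n x)

lemma src_mk (h : S.Sq n B e f) (x : V) (b : Bool) : S.src (mkc B e x, b) =
    insert (Sym2.diag (if b then S.iota e else S.tau e)) (insert (Sym2.diag x) B) := by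
  unfold src
  simp only [h.theEdge_mk x, h.erase_mk x]

lemma tgt_mk (h : S.Sq n B e f) (x : V) (b : Bool) : S.tgt (mkc B e x, b) =
    insert (Sym2.diag (if b then S.tau e else S.iota e)) (insert (Sym2.diag x) B) := by
  unfold tgt
  simp only [h.theEdge_mk x, h.erase_mk x]

lemma isCell_top (h : S.Sq n B e f) : S.IsCell n (insert e (insert f B)) := by
  refine ⟨?_, ?_, ?_⟩
  · rw [Finset.card_insert_of_notMem (by simp [h.e_nB, h.e_ne_f]),
      Finset.card_insert_of_notMem h.symm.e_nB, ← h.card]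
  · intro s hs
    simp only [Finset.mem_insert] at hs
    rcases hs with rfl | rfl | hs
    · exact Or.inr h.he
    · exact Or.inr h.hf
    · exact Or.inl (h.hB s hs)
  · intro s hs t ht hst y hys hyt
    simp only [Finset.mem_insert] at hs ht
    rcases hs with rfl | rfl | hs <;> rcases ht with rfl | rfl | ht
    · exact hst rfl
    · exact h.de y hys hyt
    · exact h.dBe t ht y hyt hys
    · exact h.de y hyt hys
    · exact hst rfl
    · exact h.dBf t ht y hyt hys
    · exact h.dBe s hs y hys hyt
    · exact h.dBf s hs y hys hyt
    · exact h.B_disj hs ht hst y hys hyt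

lemma dim_top (h : S.Sq n B e f) : dim (insert e (insert f B)) = 2 := by
  have : (insert e (insert f B)).filter (fun s => ¬ s.IsDiag) = {e, f} := by
    ext s
    simp only [Finset.mem_filter, Finset.mem_insert, Finset.mem_singleton]
    constructor
    · rintro ⟨rfl | rfl | hs, h'⟩
      · exact Or.inl rfl
      · exact Or.inr rfl
      · exact absurd (h.hB s hs) h'
    · rintro (rfl | rfl)
      · exact ⟨Or.inl rfl, not_diag_of_edge h.he⟩
      · exact ⟨Or.inr (Or.inl rfl), not_diag_of_edge h.hf⟩
  rw [dim, this, Finset.card_pair h.e_ne_f]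

lemma iota_mem (e : Sym2 V) : S.iota e ∈ e := Sym2.mem_iff_exists.2 ⟨_, (S.iota_tau e).1⟩

lemma tau_mem (e : Sym2 V) : S.tau e ∈ e :=
  Sym2.mem_iff_exists.2 ⟨_, (S.iota_tau e).1.trans Sym2.eq_swap⟩

lemma mem_edge {x : V} (e : Sym2 V) (hx : x ∈ e) : x = S.iota e ∨ x = S.tau e := by
  rw [(S.iota_tau e).1] at hx
  exact Sym2.mem_iff.1 hx

lemma iota_ne_tau (h : S.Sq n B e f) : S.iota e ≠ S.tau e := by
  intro h'
  apply h.e_ne_diag (S.tau e)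
  conv_lhs => rw [(S.iota_tau e).1, h']
  rfl

lemma mk_ne_mk (h : S.Sq n B e f) {x y : V} (hx : x ∈ f) (hxy : x ≠ y) :
    mkc B e x ≠ mkc B e y := by
  intro h'
  have h1 : Sym2.diag x ∈ mkc B e y := by rw [← h']; simp [mkc]
  simp only [mkc, Finset.mem_insert] at h1
  rcases h1 with h1 | h1 | h1
  · exact h.e_ne_diag x h1.symm
  · exact hxy (diag_inj' h1)
  · exact h.diag_nB hx h1

lemma mk_ne_mk' (h : S.Sq n B e f) (x y : V) : mkc B e x ≠ mkc B f y := by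
  intro h'
  have h1 := h.theEdge_mk x
  rw [h', h.symm.theEdge_mk y] at h1
  exact h.e_ne_f h1.symm

lemma face_iff (h : S.Sq n B e f) (c' : Finset (Sym2 V)) : IsFace c' (insert e (insert f B)) ↔
    c' ∈ [mkc B e (S.iota f), mkc B f (S.tau e), mkc B e (S.tau f), mkc B f (S.iota e)] := by
  have h1 : (insert e (insert f B)).erase e = insert f B :=
    Finset.erase_insert (by simp [h.e_nB, h.e_ne_f])
  have h2 : (insert e (insert f B)).erase f = insert e B := by
    rw [Finset.insert_comm]
    exact Finset.erase_insert (by simp [h.symm.e_nB, h.e_ne_f.symm])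
  simp only [List.mem_cons, List.not_mem_nil, or_false]
  constructor
  · rintro ⟨e', x, he', hd, hx, rfl⟩
    simp only [Finset.mem_insert] at he'
    rcases he' with rfl | rfl | he'
    · rw [h1, Finset.insert_comm]
      rcases mem_edge (S := S) _ hx with rfl | rfl
      · right; right; right; rfl
      · right; left; rfl
    · rw [h2, Finset.insert_comm]
      rcases mem_edge (S := S) _ hx with rfl | rfl
      · left; rfl
      · right; right; left; rfl
    · exact absurd (h.hB _ he') hd
  · rintro (rfl | rfl | rfl | rfl)
    · exact ⟨f, S.iota f, by simp, not_diag_of_edge h.hf, iota_mem f, by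
        rw [h2, Finset.insert_comm]; rfl⟩
    · exact ⟨e, S.tau e, by simp, not_diag_of_edge h.he, tau_mem e, by
        rw [h1, Finset.insert_comm]; rfl⟩
    · exact ⟨f, S.tau f, by simp, not_diag_of_edge h.hf, tau_mem f, by
        rw [h2, Finset.insert_comm]; rfl⟩
    · exact ⟨e, S.iota e, by simp, not_diag_of_edge h.he, iota_mem e, by
        rw [h1, Finset.insert_comm]; rfl⟩

lemma boundary (h : S.Sq n B e f) : S.IsBoundaryWord n (insert e (insert f B))
    [(mkc B e (S.iota f), true), (mkc B f (S.tau e), true), (mkc B e (S.tau f), false),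
      (mkc B f (S.iota e), false)] := by
  refine ⟨_, _, _, _, rfl, ?_, ?_, ?_, ?_, ?_, ?_, ?_⟩
  · rw [h.tgt_mk, h.symm.src_mk]; simp [Finset.insert_comm]
  · rw [h.symm.tgt_mk, h.src_mk]; simp [Finset.insert_comm]
  · rw [h.tgt_mk, h.symm.src_mk]; simp [Finset.insert_comm]
  · rw [h.symm.tgt_mk, h.src_mk]; simp [Finset.insert_comm]
  · have a1 := h.mk_ne_mk' (S.iota f) (S.tau e)
    have a2 := h.mk_ne_mk (iota_mem f) h.symm.iota_ne_tau
    have a3 := h.mk_ne_mk' (S.iota f) (S.iota e)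
    have a4 := (h.mk_ne_mk' (S.tau f) (S.tau e)).symm
    have a5 := h.symm.mk_ne_mk (tau_mem e) h.iota_ne_tau.symm
    have a6 := h.mk_ne_mk' (S.tau f) (S.iota e)
    simp [a1, a2, a3, a4, a5, a6]
  · intro x hx
    simp only [List.mem_cons, List.not_mem_nil, or_false] at hx
    rcases hx with rfl | rfl | rfl | rfl
    · exact ⟨h.isCell_mk (iota_mem f), h.dim_mk _⟩
    · exact ⟨h.symm.isCell_mk (tau_mem e), h.symm.dim_mk _⟩
    · exact ⟨h.isCell_mk (tau_mem f), h.dim_mk _⟩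
    · exact ⟨h.symm.isCell_mk (iota_mem e), h.symm.dim_mk _⟩
  · exact h.face_iff

end Sq

/-- Decomposition of a 1-cell with respect to an unblocked vertex. -/
lemma exists_sq {n : ℕ} {c : Finset (Sym2 V)} (hc : S.IsCell n c) (hdim : dim c = 1)
    {e : Sym2 V} (he : e ∈ c) (hedge : ¬ e.IsDiag) {v : V} (hv : S.Unblocked c v) :
    S.Sq n ((c.erase (Sym2.diag v)).erase e) e (S.eV v) ∧
      c = mkc ((c.erase (Sym2.diag v)).erase e) e v ∧
      c.erase (Sym2.diag v) = insert e ((c.erase (Sym2.diag v)).erase e) := by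
  obtain ⟨hvc, hb⟩ := hv
  unfold Blocked at hb
  push Not at hb
  obtain ⟨hvr, hb⟩ := hb
  have hev : e ≠ Sym2.diag v := by
    intro h; apply hedge; rw [h]; exact Sym2.diag_isDiag v
  have he1 : e ∈ c.erase (Sym2.diag v) := Finset.mem_erase.2 ⟨hev, he⟩
  have h3 : c.erase (Sym2.diag v) = insert e ((c.erase (Sym2.diag v)).erase e) :=
    (Finset.insert_erase he1).symm
  have h2 : c = mkc ((c.erase (Sym2.diag v)).erase e) e v := by
    rw [mkc, Finset.insert_comm, ← h3, Finset.insert_erase hvc]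
  refine ⟨⟨?_, ?_, S.eV_edge hvr, ?_, ?_, ?_, ?_⟩, h2, h3⟩
  · rw [Finset.card_erase_of_mem he1, Finset.card_erase_of_mem hvc, ← hc.1]
    have h1 : 1 < c.card := Finset.one_lt_card.2 ⟨e, he, _, hvc, hev⟩
    omega
  · exact (hc.2.1 e he).resolve_left hedge
  · intro s hs
    by_contra hsd
    simp only [Finset.mem_erase] at hs
    have h1 : 1 < (c.filter (fun s => ¬ s.IsDiag)).card := by
      apply Finset.one_lt_card.2
      exact ⟨s, Finset.mem_filter.2 ⟨hs.2.2, hsd⟩, e, Finset.mem_filter.2 ⟨he, hedge⟩, hs.1⟩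
    unfold dim at hdim
    omega
  · intro s hs x hx
    simp only [Finset.mem_erase] at hs
    exact hc.2.2 s hs.2.2 e he hs.1 x hx
  · intro s hs x hx hx'
    simp only [Finset.mem_erase] at hs
    exact hb s hs.2.2 hs.2.1 x hx' hx
  · intro x hx hx'
    exact hb e he hev x hx' hx

lemma step {n : ℕ} {c B : Finset (Sym2 V)} {e : Sym2 V} {v : V} (h : S.Sq n B e (S.eV v))
    (hcB : c = mkc B e v) (hred : S.Redundant n c) (hv : S.Unblocked c v)
    (hmin : ∀ u : V, S.Unblocked c u → S.vle v u) :
    MPMove S n [(c, true)] [(mkc B (S.eV v) (S.iota e), true), (mkc B e (S.par v), true),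
      (mkc B (S.eV v) (S.tau e), false)] ∧
    MPMove S n [(c, false)] [(mkc B (S.eV v) (S.tau e), true), (mkc B e (S.par v), false),
      (mkc B (S.eV v) (S.iota e), false)] := by
  have hvr : v ≠ S.root := fun h' => hv.2 (Or.inl h')
  obtain ⟨hi, ht⟩ := S.iota_eV hvr
  have hbd := h.boundary
  rw [hi, ht] at hbd
  have hvf : v ∈ S.eV v := by rw [S.eV_eq]; simp
  have hcell := h.isCell_mk hvf
  have hP : S.PrincipalRedOf c (insert e (insert (S.eV v) B)) := by
    refine ⟨v, hv, hmin, ?_⟩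
    rw [redFrom, hcB, mkc, Finset.insert_comm e (Sym2.diag v) B, Finset.erase_insert,
      Finset.insert_comm]
    simp only [Finset.mem_insert, not_or]
    exact ⟨(h.e_ne_diag v).symm, h.diag_nB hvf⟩
  have hno : ∀ x ∈ [(mkc B (S.eV v) (S.tau e), true), (mkc B e (S.par v), false),
      (mkc B (S.eV v) (S.iota e), false)], x.1 ≠ c := by
    intro x hx
    simp only [List.mem_cons, List.not_mem_nil, or_false] at hx
    rw [hcB]
    rcases hx with rfl | rfl | rfl
    · exact (h.mk_ne_mk' _ _).symm
    · exact (h.mk_ne_mk hvf (S.par_ne hvr).symm).symm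
    · exact (h.mk_ne_mk' _ _).symm
  rw [← hcB] at hcell hbd
  constructor
  · exact ⟨[], [], _, _, MPRel.square _ c (c, true) _ h.isCell_top h.dim_top hcell hred hP rfl
      hbd hno, rfl, rfl⟩
  · exact ⟨[], [], _, _, MPRel.squareInv _ c (c, true) _ h.isCell_top h.dim_top hcell hred hP rfl
      hbd hno, rfl, rfl⟩

end Setup

/-! ### Rewriting in context -/

section Rewriting

variable {V : Type} [Fintype V] [DecidableEq V] {S : Setup V} {n : ℕ}

lemma move_context {x y : List (Finset (Sym2 V) × Bool)} (h : Relation.ReflTransGen (MPMove S n) x y)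
    (a b : List (Finset (Sym2 V) × Bool)) :
    Relation.ReflTransGen (MPMove S n) (a ++ x ++ b) (a ++ y ++ b) := by
  refine Relation.ReflTransGen.lift (fun z => a ++ z ++ b) ?_ _ _ h
  rintro x y ⟨u, v, r₁, r₂, hr, rfl, rfl⟩
  exact ⟨a ++ u, v ++ b, r₁, r₂, hr, by simp, by simp⟩

lemma move_three {x : List (Finset (Sym2 V) × Bool)} {a b c : Finset (Sym2 V) × Bool}
    (h : MPMove S n x [a, b, c]) (ha : Relation.ReflTransGen (MPMove S n) [a] [])
    (hc : Relation.ReflTransGen (MPMove S n) [c] []) :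
    Relation.ReflTransGen (MPMove S n) x [b] := by
  refine (Relation.ReflTransGen.single h).trans ?_
  have h1 := move_context ha [] [b, c]
  have h2 := move_context hc [b] []
  simp only [List.nil_append, List.append_nil, List.cons_append] at h1 h2
  exact h1.trans h2

end Rewriting

namespace Setup

variable {V : Type} [Fintype V] [DecidableEq V] {S : Setup V}

lemma no_between {n : ℕ} {d : Finset (Sym2 V)} (hd : S.IsCell n d) {f : Sym2 V}
    (hf : ∀ s ∈ d, ¬ s.IsDiag → s = f) {u : V} (hu : S.Unblocked d u)
    (hmin : ∀ w : V, S.Unblocked d w → S.code u ≤ S.code w)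
    (hfu : ∀ z ∈ f, S.code u < S.code z) (m : ℕ) :
    ∀ x : V, (S.code x).length = m → Sym2.diag x ∈ d →
      S.code (S.par u) < S.code x → S.code x < S.code u → False := by
  have hur : u ≠ S.root := fun h' => hu.2 (Or.inl h')
  induction m using Nat.strong_induction_on with
  | _ m ih =>
    intro x hxm hxd h1 h2
    have hxr : x ≠ S.root := by
      rintro rfl
      rw [code_root] at h1
      simp at h1
    obtain ⟨_, b, hb⟩ := S.par_spec hxr
    obtain ⟨_, a, ha⟩ := S.par_spec hur
    have hle : S.code (S.par u) ≤ S.code (S.par x) := by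
      rw [hb] at h1 h2
      rw [ha] at h2
      exact list_between_le _ _ _ _ h1 h2
    have hparx : S.code (S.par x) < S.code u := (S.code_par_lt hxr).trans h2
    have hunb : S.Unblocked d x := by
      refine ⟨hxd, ?_⟩
      rintro (h | ⟨s, hs, hsx, y, hy, hys⟩)
      · exact hxr h
      · rw [eV_eq, Sym2.mem_iff] at hy
        rcases hy with rfl | rfl
        · exact hd.2.2 s hs _ hxd hsx y hys (mem_diag_iff'.2 rfl)
        · by_cases hsd : s.IsDiag
          · obtain ⟨z, rfl⟩ := isDiag_exists hsd
            rw [mem_diag_iff'] at hys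
            subst hys
            rcases hle.lt_or_eq with hlt | heq
            · refine ih _ ?_ (S.par x) rfl hs hlt hparx
              rw [← hxm, hb]; simp
            · have heq := S.code_inj heq
              apply hu.2
              right
              refine ⟨_, hs, ?_, S.par u, by rw [eV_eq]; simp, ?_⟩
              · intro h'
                rw [diag_inj' h'] at hparx
                exact lt_irrefl _ hparx
              · rw [heq]; exact mem_diag_iff'.2 rfl
          · have := hf s hs hsd
            subst this
            exact lt_asymm hparx (hfu _ hys)
    exact absurd (hmin x hunb) (not_le.2 h2)

lemma edge_unique {d : Finset (Sym2 V)} (hdim : dim d = 1) {f : Sym2 V} (hf : f ∈ d)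
    (hfd : ¬ f.IsDiag) : ∀ s ∈ d, ¬ s.IsDiag → s = f := by
  intro s hs hsd
  unfold dim at hdim
  exact Finset.card_le_one.1 hdim.le s (Finset.mem_filter.2 ⟨hs, hsd⟩) f
    (Finset.mem_filter.2 ⟨hf, hfd⟩)

lemma eV_not_diag {v : V} (hv : v ≠ S.root) : ¬ (S.eV v).IsDiag :=
  not_diag_of_edge (S.eV_edge hv)

/-- If `e(v)` is an edge of the 1-cell `d` with no vertices in between, and no smaller vertex of
`d` is unblocked, then `d` is collapsible. -/
lemma collapsible_of {n : ℕ} {d : Finset (Sym2 V)} (hd : S.IsCell n d) (hdim : dim d = 1)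
    {v : V} (hv : v ≠ S.root) (hvd : S.eV v ∈ d)
    (hbt : ∀ x, Sym2.diag x ∈ d → S.code (S.par v) < S.code x → S.code x < S.code v → False)
    (hno : ∀ x, S.Unblocked d x → S.code v ≤ S.code x) : S.Collapsible n d := by
  have hvf : v ∈ S.eV v := by rw [eV_eq]; simp
  have hfd := eV_not_diag (S := S) hv
  have hun := edge_unique hdim hvd hfd
  have hdj : ∀ s ∈ d, s ≠ S.eV v → ∀ y ∈ S.eV v, y ∉ s := fun s hs hsf y hy hys =>
    hd.2.2 s hs _ hvd hsf y hys hy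
  have hne : ∀ x : V, Sym2.diag x ≠ S.eV v := by
    intro x h
    apply hfd
    rw [← h]
    exact Sym2.diag_isDiag x
  have hvn : Sym2.diag v ∉ d.erase (S.eV v) := by
    intro h
    rw [Finset.mem_erase] at h
    exact hdj _ h.2 h.1 v hvf (mem_diag_iff'.2 rfl)
  have hcell : S.IsCell n (insert (Sym2.diag v) (d.erase (S.eV v))) := by
    refine ⟨?_, ?_, ?_⟩
    · rw [Finset.card_insert_of_notMem hvn, Finset.card_erase_add_one hvd, hd.1]
    · intro s hs
      simp only [Finset.mem_insert, Finset.mem_erase] at hs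
      rcases hs with rfl | ⟨_, hs⟩
      · exact Or.inl (Sym2.diag_isDiag v)
      · exact hd.2.1 s hs
    · intro s hs t ht hst y hys hyt
      simp only [Finset.mem_insert, Finset.mem_erase] at hs ht
      rcases hs with rfl | ⟨hs1, hs⟩ <;> rcases ht with rfl | ⟨ht1, ht⟩
      · exact hst rfl
      · rw [mem_diag_iff'] at hys
        subst hys
        exact hdj t ht ht1 y hvf hyt
      · rw [mem_diag_iff'] at hyt
        subst hyt
        exact hdj s hs hs1 y hvf hys
      · exact hd.2.2 s hs t ht hst y hys hyt
  have hdim0 : dim (insert (Sym2.diag v) (d.erase (S.eV v))) = 0 := by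
    unfold dim
    rw [Finset.card_eq_zero, Finset.filter_eq_empty_iff]
    intro s hs h'
    simp only [Finset.mem_insert, Finset.mem_erase] at hs
    rcases hs with rfl | ⟨hs1, hs⟩
    · exact h' (Sym2.diag_isDiag v)
    · exact hs1 (hun s hs h')
  have hunb : S.Unblocked (insert (Sym2.diag v) (d.erase (S.eV v))) v := by
    refine ⟨Finset.mem_insert_self _ _, ?_⟩
    rintro (h | ⟨s, hs, hsv, y, hy, hys⟩)
    · exact hv h
    · simp only [Finset.mem_insert, Finset.mem_erase] at hs
      rcases hs with rfl | ⟨hs1, hs⟩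
      · exact hsv rfl
      · exact hdj s hs hs1 y hy hys
  refine ⟨insert (Sym2.diag v) (d.erase (S.eV v)), hcell, ?_, v, hunb, ?_, ?_⟩
  · unfold Redundant
    rw [hdim0]
    exact ⟨v, hunb⟩
  · intro x hx
    rw [vle_iff]
    by_contra hlt
    have hlt := not_le.1 hlt
    have hxv : x ≠ v := by rintro rfl; exact lt_irrefl _ hlt
    have hxd : Sym2.diag x ∈ d := by
      have := hx.1
      simp only [Finset.mem_insert, Finset.mem_erase] at this
      rcases this with h | h
      · exact absurd (diag_inj' h) hxv
      · exact h.2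
    have hb : S.Blocked d x := by
      by_contra hb
      exact absurd (hno x ⟨hxd, hb⟩) (not_le.2 hlt)
    apply hx.2
    rcases hb with h | ⟨s, hs, hsx, y, hy, hys⟩
    · exact Or.inl h
    · by_cases hsf : s = S.eV v
      · subst hsf
        have hys' := hys
        rw [eV_eq, Sym2.mem_iff] at hys'
        rcases hys' with rfl | rfl
        · right
          exact ⟨Sym2.diag y, Finset.mem_insert_self _ _, fun h => hxv (diag_inj' h).symm, y, hy,
            mem_diag_iff'.2 rfl⟩
        · exfalso
          have hy' := hy
          rw [eV_eq, Sym2.mem_iff] at hy'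
          rcases hy' with h | h
          · exact hdj _ hxd (hne x) _ hys (mem_diag_iff'.2 h)
          · have hxr : x ≠ S.root := fun h' => hx.2 (Or.inl h')
            have h3 := S.code_par_lt hxr
            rw [← h] at h3
            exact hbt x hxd h3 hlt
      · right
        exact ⟨s, Finset.mem_insert_of_mem (Finset.mem_erase.2 ⟨hsf, hs⟩), hsx, y, hy, hys⟩
  · rw [redFrom, Finset.erase_insert hvn, Finset.insert_erase hvd]

/-- Total depth of a cell. -/
noncomputable def tdepth (S : Setup V) (d : Finset (Sym2 V)) : ℕ :=
  ∑ s ∈ d, (S.code (S.iota s)).length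

/-- Position of a vertex in the vertex order. -/
noncomputable def rank (S : Setup V) (v : V) : ℕ :=
  (Finset.univ.filter (fun w => S.code w < S.code v)).card

lemma rank_lt {u v : V} (h : S.code u < S.code v) : S.rank u < S.rank v := by
  apply Finset.card_lt_card
  rw [Finset.ssubset_iff_of_subset]
  · exact ⟨u, by simp [h], by simp⟩
  · intro w hw
    simp only [Finset.mem_filter, Finset.mem_univ, true_and] at hw ⊢
    exact hw.trans h

lemma Sq.tdepth_mk {n : ℕ} {B : Finset (Sym2 V)} {e f : Sym2 V} (h : S.Sq n B e f) {x : V}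
    (hx : x ∈ f) : S.tdepth (mkc B e x) =
      (S.code (S.iota e)).length + ((S.code x).length + S.tdepth B) := by
  unfold tdepth
  rw [mkc, Finset.sum_insert (h.e_n x), Finset.sum_insert (h.diag_nB hx), iota_diag]

/-- 1-cells whose edge `e(v)` has no vertex in between can be rewritten to the empty word. -/
lemma collapse_word (n m : ℕ) : ∀ r : ℕ, ∀ (d : Finset (Sym2 V)) (v : V), S.tdepth d = m →
    S.rank v = r → S.IsCell n d → dim d = 1 → v ≠ S.root → S.eV v ∈ d →
    (∀ x, Sym2.diag x ∈ d → S.code (S.par v) < S.code x → S.code x < S.code v → False) →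
    ∀ b : Bool, Relation.ReflTransGen (MPMove S n) [(d, b)] [] := by
  induction m using Nat.strong_induction_on with
  | _ m ihm =>
  intro r
  induction r using Nat.strong_induction_on with
  | _ r ihr =>
  intro d v hm hr hd hdim hv hvd hbt b
  by_cases hcol : S.Collapsible n d
  · exact Relation.ReflTransGen.single ⟨[], [], _, _, MPRel.collapse (d, b) hd hdim hcol, rfl, rfl⟩
  have hex : ∃ x, S.Unblocked d x ∧ S.code x < S.code v := by
    by_contra hno
    push Not at hno
    exact hcol (collapsible_of hd hdim hv hvd hbt hno)
  obtain ⟨x, hx, hxv⟩ := hex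
  obtain ⟨u, hu, hmin⟩ := Finset.exists_min_image
    (Finset.univ.filter (fun w => S.Unblocked d w)) S.code ⟨x, by simp [hx]⟩
  simp only [Finset.mem_filter, Finset.mem_univ, true_and] at hu hmin
  have huv : S.code u < S.code v := (hmin x hx).trans_lt hxv
  have hred : S.Redundant n d := by
    unfold Redundant
    rw [hdim]
    refine ⟨⟨u, hu⟩, ?_⟩
    rintro ⟨c₀, h1, h2, h3, h4⟩
    refine hcol ⟨c₀, h1, ?_, h4⟩
    unfold Redundant
    rw [h2]
    exact h3
  have hur : u ≠ S.root := fun h' => hu.2 (Or.inl h')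
  have hfd := eV_not_diag (S := S) hv
  obtain ⟨hsq, hdB, -⟩ := exists_sq hd hdim hvd hfd hu
  generalize (d.erase (Sym2.diag u)).erase (S.eV v) = B at hsq hdB
  have hpf : S.par v ∈ S.eV v := by rw [eV_eq]; simp
  have hvf : v ∈ S.eV v := by rw [eV_eq]; simp
  have huf : u ∈ S.eV u := by rw [eV_eq]; simp
  have hpuf : S.par u ∈ S.eV u := by rw [eV_eq]; simp
  have hup : S.code u < S.code (S.par v) := by
    by_contra h
    have h := not_lt.1 h
    rcases h.lt_or_eq with h | h
    · exact hbt u hu.1 h huv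
    · have h := S.code_inj h
      exact hsq.de _ hpf (h ▸ huf)
  have hnb := no_between hd (edge_unique hdim hvd hfd) hu hmin (by
    intro z hz
    rw [eV_eq, Sym2.mem_iff] at hz
    rcases hz with rfl | rfl
    · exact huv
    · exact hup)
  obtain ⟨hi, ht⟩ := S.iota_eV hv
  obtain ⟨hi', ht'⟩ := S.iota_eV hur
  obtain ⟨hs1, hs2⟩ := step hsq hdB hred hu (fun w hw => (S.vle_iff u w).2 (hmin w hw))
  rw [hi, ht] at hs1 hs2
  have hBd : ∀ s ∈ B, s ∈ d := by
    intro s hs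
    rw [hdB]
    simp [mkc, hs]
  have hlen_u : (S.code (S.par u)).length < (S.code u).length := by
    obtain ⟨_, a, ha⟩ := S.par_spec hur
    rw [ha]; simp
  have hlen_v : (S.code (S.par v)).length < (S.code v).length := by
    obtain ⟨_, a, ha⟩ := S.par_spec hv
    rw [ha]; simp
  have hmd := hsq.tdepth_mk huf
  rw [← hdB, hi, hm] at hmd
  have hm1 := hsq.tdepth_mk hpuf
  rw [hi] at hm1
  have hm2 := hsq.symm.tdepth_mk hvf
  rw [hi'] at hm2
  have hm3 := hsq.symm.tdepth_mk hpf
  rw [hi'] at hm3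
  have hmem : ∀ (f : Sym2 V) (y x : V), ¬ f.IsDiag → Sym2.diag x ∈ mkc B f y →
      x = y ∨ Sym2.diag x ∈ d := by
    intro f y x hf hx
    simp only [mkc, Finset.mem_insert] at hx
    rcases hx with hx | hx | hx
    · exact absurd (hx ▸ Sym2.diag_isDiag x) hf
    · exact Or.inl (diag_inj' hx)
    · exact Or.inr (hBd _ hx)
  have hd1 : ∀ b : Bool, Relation.ReflTransGen (MPMove S n) [(mkc B (S.eV v) (S.par u), b)] [] := by
    refine ihm _ ?_ _ _ v rfl rfl (hsq.isCell_mk hpuf) (hsq.dim_mk _) hv (by simp [mkc]) ?_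
    · omega
    · intro x hx h1 h2
      rcases hmem _ _ _ hfd hx with rfl | hx
      · exact lt_asymm (h1.trans (S.code_par_lt hur)) hup
      · exact hbt x hx h1 h2
  have hfu := eV_not_diag (S := S) hur
  have hd2 : ∀ b : Bool, Relation.ReflTransGen (MPMove S n) [(mkc B (S.eV u) v, b)] [] := by
    refine ihr (S.rank u) ?_ _ u ?_ rfl (hsq.symm.isCell_mk hvf) (hsq.symm.dim_mk _) hur
      (by simp [mkc]) ?_
    · rw [← hr]; exact rank_lt huv
    · omega
    · intro x hx h1 h2
      rcases hmem _ _ _ hfu hx with rfl | hx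
      · exact lt_asymm h2 huv
      · exact hnb _ x rfl hx h1 h2
  have hd3 : ∀ b : Bool,
      Relation.ReflTransGen (MPMove S n) [(mkc B (S.eV u) (S.par v), b)] [] := by
    refine ihm _ ?_ _ _ u rfl rfl (hsq.symm.isCell_mk hpf) (hsq.symm.dim_mk _) hur
      (by simp [mkc]) ?_
    · omega
    · intro x hx h1 h2
      rcases hmem _ _ _ hfu hx with rfl | hx
      · exact lt_asymm h2 hup
      · exact hnb _ x rfl hx h1 h2
  cases b with
  | true => exact (move_three hs1 (hd2 _) (hd3 _)).trans (hd1 _)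
  | false => exact (move_three hs2 (hd3 _) (hd2 _)).trans (hd1 _)

end Setup


/-- **Redundant 1-cells lemma.**  Let `c` be a redundant 1-cell with unique edge `e`, let
`v` be the smallest unblocked vertex of `c`, and let `c'` be obtained from `c` by
replacing `v` with `τ(e(v))`.  If no vertex strictly between `τ(e(v))` and `v` in the
vertex order is an element of `c` or an endpoint of `e`, then `c →̇ c'`. -/
theorem stmt17 {V : Type} [Fintype V] [DecidableEq V] (S : Setup V) (n : ℕ) (hn : 1 ≤ n) (hsub : S.SuffSubdiv n)
    (c : Finset (Sym2 V)) (hc : S.IsCell n c) (hdim : Setup.dim c = 1)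
    (hred : S.Redundant n c) (e : Sym2 V) (he : e ∈ c) (hedge : ¬ e.IsDiag)
    (v : V) (hv : S.Unblocked c v) (hmin : ∀ u : V, S.Unblocked c u → S.vle v u)
    (hbetween : ∀ u : V, S.vlt (S.tau (S.eV v)) u → S.vlt u v → Sym2.diag u ∉ c ∧ u ∉ e) :
    Relation.ReflTransGen (MPMove S n) [(c, true)]
      [(insert (Sym2.diag (S.tau (S.eV v))) (c.erase (Sym2.diag v)), true)] := by
  have hvr : v ≠ S.root := fun h' => hv.2 (Or.inl h')
  obtain ⟨hi, ht⟩ := S.iota_eV hvr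
  obtain ⟨hsq, hcB, hcB'⟩ := Setup.exists_sq hc hdim he hedge hv
  rw [ht] at hbetween ⊢
  rw [hcB']
  generalize (c.erase (Sym2.diag v)).erase e = B at hsq hcB
  have hs := (Setup.step hsq hcB hred hv hmin).1
  have key : ∀ y ∈ e, ∀ b : Bool,
      Relation.ReflTransGen (MPMove S n) [(Setup.mkc B (S.eV v) y, b)] [] := by
    intro y hy
    refine Setup.collapse_word n _ _ _ v rfl rfl (hsq.symm.isCell_mk hy) (hsq.symm.dim_mk _) hvr
      (by simp [Setup.mkc]) ?_
    intro x hx h1 h2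
    obtain ⟨h3, h4⟩ := hbetween x ((S.vlt_iff _ _).2 h1) ((S.vlt_iff _ _).2 h2)
    simp only [Setup.mkc, Finset.mem_insert] at hx
    rcases hx with hx | hx | hx
    · exact hsq.symm.e_ne_diag x hx.symm
    · exact h4 (diag_inj' hx ▸ hy)
    · apply h3
      rw [hcB]
      simp [Setup.mkc, hx]
  have hfin := move_three hs (key _ (Setup.Sq.iota_mem e) _) (key _ (Setup.Sq.tau_mem e) _)
  rw [Finset.insert_comm]
  exact hfin

end GraphBraid
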